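/- Let p be a prime number and let a, b, a', b' be nonzero elements of ℚ_p with a ≠ b and a' ≠ b'. Assume ν_p(a) = ν_p(b), ν_p(a−b) = ν_p(b), ν_p(a') = ν_p(b') and ν_p(a'−b') = ν_p(b') (these conditions express that both elliptic curves y² = x(x−a)(x−b) and y² = x(x−a')(x−b') have potential good reduction). Then the number of kernel vectors of M_{aba'b'} is 1, 4, or 16; i.e., the kernel of M_{aba'b'} has even 𝔽₂-dimension. -/

import Mathlib

/-- The Skorobogatov–Zarhin matrix `M_{aba'b'}`. -/
def SZMatrix {k : Type*} [Field k] (a b a' b' : k) : Fin 4 → Fin 4 → k :=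
  ![![1, a * b, a' * b', -(a * a')],
    ![a * b, 1, a * a', a' * (a' - b')],
    ![a' * b', a * a', 1, a * (a - b)],
    ![-(a * a'), a' * (a' - b'), a * (a - b), 1]]

/-- `ε ∈ 𝔽₂⁴` is a kernel vector of `M_{aba'b'}` if for every row `i` the product of
those entries `M i j` with `ε j = 1` is a square in `k`. -/
def IsKernelVector {k : Type*} [Field k] (a b a' b' : k) (ε : Fin 4 → ZMod 2) : Prop :=
  ∀ i : Fin 4,
    IsSquare (∏ j ∈ Finset.univ.filter (fun j : Fin 4 => ε j = 1), SZMatrix a b a' b' i j)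

open Polynomial in
theorem PadicInt.isSquare_of_isSquare_toZMod {p : ℕ} [Fact p.Prime] (hp : p ≠ 2) {x : ℤ_[p]}
    (hx : ‖x‖ = 1) (h : IsSquare (PadicInt.toZMod x)) : IsSquare x := by
  obtain ⟨r, hr⟩ := h
  obtain ⟨a, rfl⟩ := ZMod.ringHom_surjective (PadicInt.toZMod (p := p)) r
  have norm_lt_one_iff (y : ℤ_[p]) : ‖y‖ < 1 ↔ PadicInt.toZMod y = 0 := by
    rw [← RingHom.mem_ker, PadicInt.ker_toZMod, IsLocalRing.mem_maximalIdeal, PadicInt.mem_nonunits]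
  have norm_eq_one_iff (y : ℤ_[p]) : ‖y‖ = 1 ↔ PadicInt.toZMod y ≠ 0 := by
    rw [Ne, ← norm_lt_one_iff, not_lt]
    exact ⟨fun h => h.ge, fun h => le_antisymm y.norm_le_one h⟩
  have ha : PadicInt.toZMod a ≠ 0 := by
    intro h0
    exact (norm_eq_one_iff x).1 hx (by rw [hr, h0, mul_zero])
  have h2 : (2 : ZMod p) ≠ 0 := by
    exact Ring.two_ne_zero (by rwa [ZMod.ringChar_zmod_n])
  have hd : ‖(X ^ 2 - C x : ℤ_[p][X]).derivative.aeval a‖ = 1 := by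
    rw [norm_eq_one_iff]
    simpa [one_add_one_eq_two, map_ofNat (PadicInt.toZMod (p := p)) 2] using And.intro h2 ha
  have hlt : ‖(X ^ 2 - C x : ℤ_[p][X]).aeval a‖ <
      ‖(X ^ 2 - C x : ℤ_[p][X]).derivative.aeval a‖ ^ 2 := by
    rw [hd, one_pow, norm_lt_one_iff]
    simp [hr, pow_two]
  obtain ⟨z, hz, -⟩ := hensels_lemma hlt
  refine ⟨z, ?_⟩
  simp only [map_sub, map_pow, aeval_X, aeval_C, Algebra.algebraMap_self, RingHom.id_apply] at hz
  linear_combination -hz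

namespace Padic

variable {p : ℕ} [Fact p.Prime]

theorem even_valuation_of_isSquare {x : ℚ_[p]} (hx : x ≠ 0) (h : IsSquare x) :
    Even x.valuation := by
  obtain ⟨r, rfl⟩ := h
  have hr : r ≠ 0 := left_ne_zero_of_mul hx
  rw [valuation_mul hr hr]
  exact ⟨_, rfl⟩

theorem norm_eq_one_of_valuation_eq_zero {x : ℚ_[p]} (hx : x ≠ 0) (h : x.valuation = 0) :
    ‖x‖ = 1 := by
  simp [norm_eq_zpow_neg_valuation hx, h]

theorem exists_eq_unit_mul_sq {x : ℚ_[p]} (hx : x ≠ 0) (h : Even x.valuation) :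
    ∃ (u : ℤ_[p]ˣ) (c : ℚ_[p]), x = ((u : ℤ_[p]) : ℚ_[p]) * (c * c) := by
  obtain ⟨n, hn⟩ := h
  have hp : (p : ℚ_[p]) ≠ 0 := mod_cast (Fact.out : p.Prime).ne_zero
  have hc : (p : ℚ_[p]) ^ n ≠ 0 := zpow_ne_zero _ hp
  have hcc : ((p : ℚ_[p]) ^ n * (p : ℚ_[p]) ^ n) ≠ 0 := mul_ne_zero hc hc
  have hy : ‖x * ((p : ℚ_[p]) ^ n * (p : ℚ_[p]) ^ n)⁻¹‖ = 1 := by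
    refine norm_eq_one_of_valuation_eq_zero (mul_ne_zero hx (inv_ne_zero hcc)) ?_
    rw [valuation_mul hx (inv_ne_zero hcc), valuation_inv, valuation_mul hc hc, valuation_zpow,
      valuation_p, hn]
    ring
  refine ⟨PadicInt.mkUnits hy, (p : ℚ_[p]) ^ n, ?_⟩
  rw [PadicInt.mkUnits_eq, inv_mul_cancel_right₀ hcc]

theorem isSquare_mul_iff_of_isSquare {x y : ℚ_[p]} (hx : x ≠ 0)
    (h : IsSquare x) : IsSquare (x * y) ↔ IsSquare y := by
  refine ⟨fun hxy => ?_, h.mul⟩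
  simpa [mul_div_cancel_left₀ y hx] using hxy.div h

theorem isSquare_mul_of_not_isSquare (hp : p ≠ 2) {x y : ℚ_[p]} (hx : x ≠ 0) (hy : y ≠ 0)
    (hvx : Even x.valuation) (hvy : Even y.valuation) (hsx : ¬IsSquare x) (hsy : ¬IsSquare y) :
    IsSquare (x * y) := by
  obtain ⟨u, c, rfl⟩ := exists_eq_unit_mul_sq hx hvx
  obtain ⟨v, d, rfl⟩ := exists_eq_unit_mul_sq hy hvy
  have residue_not_isSquare (w : ℤ_[p]ˣ) (e : ℚ_[p])
      (h : ¬IsSquare (((w : ℤ_[p]) : ℚ_[p]) * (e * e))) :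
      quadraticChar (ZMod p) (PadicInt.toZMod (w : ℤ_[p])) = -1 := by
    rw [quadraticChar_neg_one_iff_not_isSquare]
    intro hw
    have := PadicInt.isSquare_of_isSquare_toZMod hp (PadicInt.norm_units w) hw
    exact h ((this.map PadicInt.Coe.ringHom).mul ⟨e, rfl⟩)
  have huv : IsSquare (PadicInt.toZMod ((u * v : ℤ_[p]ˣ) : ℤ_[p])) := by
    have hne := ((u * v).isUnit.map (PadicInt.toZMod (p := p))).ne_zero
    rw [← quadraticChar_one_iff_isSquare hne, Units.val_mul, map_mul, map_mul,
      residue_not_isSquare u c hsx, residue_not_isSquare v d hsy]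
    norm_num
  obtain ⟨r, hr⟩ := PadicInt.isSquare_of_isSquare_toZMod hp (PadicInt.norm_units _) huv
  have hr' := congrArg (fun t : ℤ_[p] => (t : ℚ_[p])) hr
  simp only [Units.val_mul, PadicInt.coe_mul] at hr'
  exact ⟨r * (c * d), by linear_combination (c * d) ^ 2 * hr'⟩

open scoped Classical in
/-- The additive quadratic character: `0` on squares and `1` on nonsquares. -/
noncomputable def squareClass (x : ℚ_[p]) : ZMod 2 := if IsSquare x then 0 else 1

theorem squareClass_eq_zero_iff {x : ℚ_[p]} : squareClass x = 0 ↔ IsSquare x := by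
  simp [squareClass]

open scoped Classical in
theorem squareClass_mul (hp : p ≠ 2) {x y : ℚ_[p]} (hx : x ≠ 0) (hy : y ≠ 0)
    (hvx : Even x.valuation) (hvy : Even y.valuation) :
    squareClass (x * y) = squareClass x + squareClass y := by
  by_cases hsx : IsSquare x
  · rw [squareClass_eq_zero_iff.2 hsx, zero_add]
    exact if_congr (isSquare_mul_iff_of_isSquare hx hsx) rfl rfl
  by_cases hsy : IsSquare y
  · rw [squareClass_eq_zero_iff.2 hsy, add_zero, mul_comm]
    exact if_congr (isSquare_mul_iff_of_isSquare hy hsy) rfl rfl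
  · simp only [squareClass, isSquare_mul_of_not_isSquare hp hx hy hvx hvy hsx hsy, hsx, hsy,
      if_true, if_false]
    decide

theorem valuation_prod {ι : Type*} (s : Finset ι) {f : ι → ℚ_[p]} (hf : ∀ i, f i ≠ 0) :
    (∏ i ∈ s, f i).valuation = ∑ i ∈ s, (f i).valuation := by
  classical
  induction s using Finset.induction_on with
  | empty => simp
  | insert i s hi ih =>
    rw [Finset.prod_insert hi, Finset.sum_insert hi,
      valuation_mul (hf i) (Finset.prod_ne_zero_iff.2 fun j _ => hf j), ih]

theorem squareClass_prod (hp : p ≠ 2) {ι : Type*} (s : Finset ι) {f : ι → ℚ_[p]}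
    (hf : ∀ i, f i ≠ 0) (hv : ∀ i, Even (f i).valuation) :
    squareClass (∏ i ∈ s, f i) = ∑ i ∈ s, squareClass (f i) := by
  classical
  induction s using Finset.induction_on with
  | empty => simp [squareClass]
  | insert i s hi ih =>
    rw [Finset.prod_insert hi, Finset.sum_insert hi,
      squareClass_mul hp (hf i) (Finset.prod_ne_zero_iff.2 fun j _ => hf j) (hv i), ih]
    rw [valuation_prod s hf]
    exact Finset.even_sum _ fun j _ => hv j

theorem prime_ne_two_of_valuation_sub_eq {a b : ℚ_[p]} (ha : a ≠ 0) (hb : b ≠ 0) (hab : a ≠ b)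
    (h1 : a.valuation = b.valuation) (h2 : (a - b).valuation = b.valuation) : p ≠ 2 := by
  rintro rfl
  have hbi := inv_ne_zero hb
  have hab' := sub_ne_zero.2 hab
  have hu : ‖a * b⁻¹‖ = 1 := norm_eq_one_of_valuation_eq_zero (mul_ne_zero ha hbi) (by
    rw [valuation_mul ha hbi, valuation_inv, h1, add_neg_cancel])
  have hw : ‖(a - b) * b⁻¹‖ = 1 := norm_eq_one_of_valuation_eq_zero (mul_ne_zero hab' hbi) (by
    rw [valuation_mul hab' hbi, valuation_inv, h2, add_neg_cancel])
  have hsum : (PadicInt.mkUnits hw : ℤ_[2]) = PadicInt.mkUnits hu - 1 := by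
    apply Subtype.ext
    rw [PadicInt.coe_sub, PadicInt.mkUnits_eq, PadicInt.mkUnits_eq, PadicInt.coe_one, sub_mul,
      mul_inv_cancel₀ hb]
  have eq_one (u : ℤ_[2]ˣ) : PadicInt.toZMod (u : ℤ_[2]) = 1 := by
    have hne := (u.isUnit.map (PadicInt.toZMod (p := 2))).ne_zero
    exact Fin.eq_one_of_ne_zero _ hne
  have := congrArg PadicInt.toZMod hsum
  rw [map_sub, eq_one, eq_one, map_one] at this
  simp at this

end Padic

theorem card_kernel_of_alternating_fin_four (A : Fin 4 → Fin 4 → ZMod 2)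
    (hsymm : ∀ i j, A i j = A j i) (hdiag : ∀ i, A i i = 0) :
    {ε : Fin 4 → ZMod 2 | ∀ i, ∑ j, ε j * A i j = 0}.ncard = 1 ∨
    {ε : Fin 4 → ZMod 2 | ∀ i, ∑ j, ε j * A i j = 0}.ncard = 4 ∨
    {ε : Fin 4 → ZMod 2 | ∀ i, ∑ j, ε j * A i j = 0}.ncard = 16 := by
  have card_eq (u v w x y z : ZMod 2) :
      (Finset.univ.filter fun ε : Fin 4 → ZMod 2 =>
        ε 1 * u + ε 2 * v + ε 3 * w = 0 ∧ ε 0 * u + ε 2 * x + ε 3 * y = 0 ∧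
        ε 0 * v + ε 1 * x + ε 3 * z = 0 ∧ ε 0 * w + ε 1 * y + ε 2 * z = 0).card ∈
        ({1, 4, 16} : Finset ℕ) := by
    revert u v w x y z
    decide +kernel
  have hset : {ε : Fin 4 → ZMod 2 | ∀ i, ∑ j, ε j * A i j = 0} =
      ↑(Finset.univ.filter fun ε : Fin 4 → ZMod 2 =>
        ε 1 * A 0 1 + ε 2 * A 0 2 + ε 3 * A 0 3 = 0 ∧
        ε 0 * A 0 1 + ε 2 * A 1 2 + ε 3 * A 1 3 = 0 ∧
        ε 0 * A 0 2 + ε 1 * A 1 2 + ε 3 * A 2 3 = 0 ∧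
        ε 0 * A 0 3 + ε 1 * A 1 3 + ε 2 * A 2 3 = 0) := by
    ext ε
    simp [Fin.forall_fin_succ, Fin.sum_univ_four, hdiag, hsymm 1 0, hsymm 2 0, hsymm 3 0,
      hsymm 2 1, hsymm 3 1, hsymm 3 2]
  rw [hset, Set.ncard_coe_finset]
  simpa using card_eq (A 0 1) (A 0 2) (A 0 3) (A 1 2) (A 1 3) (A 2 3)

theorem sum_filter_eq_one_eq_sum_mul (ε f : Fin 4 → ZMod 2) :
    ∑ j ∈ Finset.univ.filter (fun j => ε j = 1), f j = ∑ j, ε j * f j := by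
  rw [Finset.sum_filter]
  refine Finset.sum_congr rfl fun j _ => ?_
  have h : ∀ x y : ZMod 2, (if x = 1 then y else 0) = x * y := by decide
  exact h _ _

theorem stmt2 (p : ℕ) [Fact p.Prime] (a b a' b' : ℚ_[p])
    (ha : a ≠ 0) (hb : b ≠ 0) (ha' : a' ≠ 0) (hb' : b' ≠ 0)
    (hab : a ≠ b) (hab' : a' ≠ b')
    (h1 : a.valuation = b.valuation) (h2 : (a - b).valuation = b.valuation)
    (h3 : a'.valuation = b'.valuation) (h4 : (a' - b').valuation = b'.valuation) :
    {ε : Fin 4 → ZMod 2 | IsKernelVector a b a' b' ε}.ncard = 1 ∨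
    {ε : Fin 4 → ZMod 2 | IsKernelVector a b a' b' ε}.ncard = 4 ∨
    {ε : Fin 4 → ZMod 2 | IsKernelVector a b a' b' ε}.ncard = 16 := by
  have hp := Padic.prime_ne_two_of_valuation_sub_eq ha hb hab h1 h2
  have hs : a - b ≠ 0 := sub_ne_zero.2 hab
  have hs' : a' - b' ≠ 0 := sub_ne_zero.2 hab'
  have hM : ∀ i j, SZMatrix a b a' b' i j ≠ 0 := by
    intro i j
    fin_cases i <;> fin_cases j <;> simp [SZMatrix, ha, hb, ha', hb', hs, hs']
  have hneg : (-(a * a')).valuation = b.valuation + b'.valuation := by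
    rw [← neg_one_mul, Padic.valuation_mul (by simp) (mul_ne_zero ha ha'),
      Padic.valuation_mul ha ha', h1, h3]
    have h : (-1 : ℚ_[p]).valuation = 0 := by
      simpa [padicValInt] using Padic.valuation_intCast (p := p) (-1)
    rw [h, zero_add]
  have hval : ∀ i j, ((SZMatrix a b a' b' i j).valuation : ZMod 2) =
      if j = i.rev then ((b.valuation + b'.valuation : ℤ) : ZMod 2) else 0 := by
    intro i j
    fin_cases i <;> fin_cases j <;>
      simp [SZMatrix, Padic.valuation_mul, ha, hb, ha', hb', hs, hs', hneg, h1, h2, h3, h4,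
        CharTwo.add_self_eq_zero, Fin.rev]
  by_cases hev : Even (b.valuation + b'.valuation)
  · have hMv : ∀ i j, Even (SZMatrix a b a' b' i j).valuation := by
      intro i j
      rw [← ZMod.intCast_eq_zero_iff_even, hval, (ZMod.intCast_eq_zero_iff_even).2 hev, ite_self]
    have hker : ∀ ε, IsKernelVector a b a' b' ε ↔
        ∀ i, ∑ j, ε j * Padic.squareClass (SZMatrix a b a' b' i j) = 0 := by
      intro ε
      refine forall_congr' fun i => ?_
      rw [← Padic.squareClass_eq_zero_iff, Padic.squareClass_prod hp _ (hM i) (hMv i),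
        sum_filter_eq_one_eq_sum_mul]
    simp only [hker]
    refine card_kernel_of_alternating_fin_four
      (fun i j => Padic.squareClass (SZMatrix a b a' b' i j)) (fun i j => ?_) (fun i => ?_)
    · fin_cases i <;> fin_cases j <;> rfl
    · rw [Padic.squareClass_eq_zero_iff]
      fin_cases i <;> exact IsSquare.one
  · left
    rw [Set.ncard_eq_one]
    refine ⟨0, Set.eq_singleton_iff_unique_mem.2 ⟨fun i => by simp, fun ε hε => ?_⟩⟩
    funext j
    have h := Padic.even_valuation_of_isSquare
      (Finset.prod_ne_zero_iff.2 fun k _ => hM j.rev k) (hε j.rev)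
    rw [← ZMod.intCast_eq_zero_iff_even, Padic.valuation_prod _ (hM j.rev), Int.cast_sum,
      sum_filter_eq_one_eq_sum_mul ε fun k => ((SZMatrix a b a' b' j.rev k).valuation : ZMod 2)]
      at h
    simp only [hval, Fin.rev_rev, mul_ite, mul_zero, Finset.sum_ite_eq', Finset.mem_univ,
      if_true] at h
    exact (mul_eq_zero.1 h).resolve_right fun h0 => hev (ZMod.intCast_eq_zero_iff_even.1 h0)
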